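/- Let v ∈ μ_{q−1}, u = v^{1−p}, and w ∈ μ_{q−1}. Then the set {exp(p·v^{−p}·(w − w^p)·x) : x ∈ ℤ_p} is a subgroup of 1 + P_K and is contained in the norm group N(M_u/K). -/

import Mathlib

open Polynomial Filter IntermediateField

variable (p : ℕ) [Fact p.Prime]

/-- A fixed algebraic closure of `ℚ_p`. -/
noncomputable abbrev Qpbar := AlgebraicClosure ℚ_[p]

/-- The unramified extension `K` of `ℚ_p` of degree `d` inside `ℚ̄_p`, realized as the
splitting field of `X^(p^d - 1) - 1`. -/
noncomputable def Kur (d : ℕ) : IntermediateField ℚ_[p] (Qpbar p) :=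
  IntermediateField.adjoin ℚ_[p] {x : Qpbar p | x ^ (p ^ d - 1) = 1}

/-- `ψ_u(X) = X (X + u p)^{p-1} + p` as a polynomial over `ℚ̄_p`. -/
noncomputable def psiPoly (u : Qpbar p) : Polynomial (Qpbar p) :=
  X * (X + C (u * (p : Qpbar p))) ^ (p - 1) + C (p : Qpbar p)

/-- `M_u`: the splitting field of `ψ_u` over `K` inside `ℚ̄_p`. -/
noncomputable def Mfield (d : ℕ) (u : Qpbar p) : IntermediateField (Kur p d) (Qpbar p) :=
  IntermediateField.adjoin (Kur p d) {x : Qpbar p | (psiPoly p u).IsRoot x}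

/-- `IsExpOf p abv y w`: `w` is the value of the `p`-adic exponential series at `y`. -/
def IsExpOf (abv : AbsoluteValue (Qpbar p) ℝ) (y w : Qpbar p) : Prop :=
  Tendsto (fun N => abv (w - ∑ n ∈ Finset.range N, y ^ n / (Nat.factorial n : Qpbar p)))
    atTop (nhds 0)

section helpers

variable {p}

/-- Nonarchimedean property. -/
theorem abv_nonarch {abv : AbsoluteValue (Qpbar p) ℝ}
    (habv : ∀ x : ℚ_[p], abv (algebraMap ℚ_[p] (Qpbar p) x) = ‖x‖) (x y : Qpbar p) :
    abv (x + y) ≤ max (abv x) (abv y) := by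
  have h := spectralNorm_unique_field_norm_ext (K := ℚ_[p]) (L := Qpbar p) habv
  rw [h, h, h]
  exact isNonarchimedean_spectralNorm x y

theorem abv_nonarch_sub {abv : AbsoluteValue (Qpbar p) ℝ}
    (habv : ∀ x : ℚ_[p], abv (algebraMap ℚ_[p] (Qpbar p) x) = ‖x‖) (x y : Qpbar p) :
    abv (x - y) ≤ max (abv x) (abv y) := by
  have := abv_nonarch habv x (-y)
  rwa [abv.map_neg, ← sub_eq_add_neg] at this

theorem abv_sum_le {abv : AbsoluteValue (Qpbar p) ℝ}
    (habv : ∀ x : ℚ_[p], abv (algebraMap ℚ_[p] (Qpbar p) x) = ‖x‖)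
    {ι : Type*} (s : Finset ι) (f : ι → Qpbar p) (C : ℝ) (hC : 0 ≤ C)
    (h : ∀ i ∈ s, abv (f i) ≤ C) : abv (∑ i ∈ s, f i) ≤ C := by
  classical
  induction s using Finset.induction_on with
  | empty => simpa using hC
  | insert a s ha ih =>
    rw [Finset.sum_insert ha]
    refine (abv_nonarch habv _ _).trans (max_le (h a (by simp)) (ih fun i hi => h i (by simp [hi])))

theorem abv_p {abv : AbsoluteValue (Qpbar p) ℝ}
    (habv : ∀ x : ℚ_[p], abv (algebraMap ℚ_[p] (Qpbar p) x) = ‖x‖) :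
    abv (p : Qpbar p) = (p : ℝ)⁻¹ := by
  have := habv (p : ℚ_[p])
  simpa using this

theorem abv_root {abv : AbsoluteValue (Qpbar p) ℝ} {d : ℕ} (hd : 0 < d) {x : Qpbar p}
    (hx : x ^ (p ^ d - 1) = 1) : abv x = 1 := by
  have h1 : 1 < p ^ d := Nat.one_lt_pow hd.ne' (Fact.out : p.Prime).one_lt
  have := congrArg abv hx
  rw [map_pow, map_one] at this
  exact (pow_eq_one_iff_of_nonneg (abv.nonneg _) (by omega)).1 this

/-- The ring `ℤ_p[μ_{q-1}]`. -/
noncomputable def Aur (p : ℕ) [Fact p.Prime] (d : ℕ) : Subalgebra ℤ_[p] (Qpbar p) :=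
  Algebra.adjoin ℤ_[p] {x : Qpbar p | x ^ (p ^ d - 1) = 1}

theorem algMap_Zp (x : ℤ_[p]) :
    algebraMap ℤ_[p] (Qpbar p) x = algebraMap ℚ_[p] (Qpbar p) (x : ℚ_[p]) := by
  rw [IsScalarTower.algebraMap_apply ℤ_[p] ℚ_[p] (Qpbar p)]; rfl

theorem Zp_pow_q (d : ℕ) (r : ℤ_[p]) : ∃ s : ℤ_[p], r ^ (p ^ d) = r + p * s := by
  have : r ^ (p ^ d) - r ∈ Ideal.span {(p : ℤ_[p])} := by
    rw [← PadicInt.maximalIdeal_eq_span_p, ← PadicInt.ker_toZMod, RingHom.mem_ker, map_sub, map_pow,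
      ZMod.pow_card_pow, sub_self]
  obtain ⟨s, hs⟩ := Ideal.mem_span_singleton'.1 this
  exact ⟨s, by linear_combination -hs⟩

theorem Aur_frob {d : ℕ} {x : Qpbar p} (hx : x ∈ Aur p d) :
    ∃ b ∈ Aur p d, x ^ (p ^ d) = x + p * b := by
  induction hx using Algebra.adjoin_induction with
  | mem x hx =>
    refine ⟨0, zero_mem _, ?_⟩
    have h0 : 0 < p ^ d := pow_pos (Fact.out : p.Prime).pos d
    obtain ⟨n, hn⟩ : ∃ n, p ^ d = n + 1 := ⟨p ^ d - 1, by omega⟩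
    simp only [Set.mem_ofPred_eq, hn, Nat.add_sub_cancel] at hx
    rw [hn, pow_succ, hx]; simp
  | algebraMap r =>
    obtain ⟨s, hs⟩ := Zp_pow_q d r
    exact ⟨algebraMap _ _ s, Subalgebra.algebraMap_mem _ _, by rw [← map_pow, hs]; simp⟩
  | add x y hx hy ihx ihy =>
    obtain ⟨b, hb, hxb⟩ := ihx
    obtain ⟨c, hc, hyc⟩ := ihy
    obtain ⟨r, hr⟩ := exists_add_pow_prime_pow_eq (Fact.out : p.Prime) (⟨x, hx⟩ : Aur p d) ⟨y, hy⟩ d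
    have hr' := congrArg Subtype.val hr
    simp at hr'
    refine ⟨b + c + x * y * r, add_mem (add_mem hb hc) (mul_mem (mul_mem hx hy) r.2), ?_⟩
    rw [hr', hxb, hyc]; ring
  | mul x y hx hy ihx ihy =>
    obtain ⟨b, hb, hxb⟩ := ihx
    obtain ⟨c, hc, hyc⟩ := ihy
    refine ⟨x * c + y * b + p * b * c, ?_, ?_⟩
    · exact add_mem (add_mem (mul_mem hx hc) (mul_mem hy hb))
        (mul_mem (mul_mem (_root_.natCast_mem _ _) hb) hc)
    · rw [mul_pow, hxb, hyc]; ring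

theorem Aur_frob_iter {d : ℕ} {x : Qpbar p} (hx : x ∈ Aur p d) (k : ℕ) :
    ∃ b ∈ Aur p d, x ^ ((p ^ d) ^ k) = x + p * b := by
  induction k with
  | zero => exact ⟨0, zero_mem _, by simp⟩
  | succ k ih =>
    obtain ⟨b, hb, hxb⟩ := ih
    obtain ⟨c, hc, hyc⟩ := Aur_frob (pow_mem hx ((p ^ d) ^ k))
    exact ⟨b + c, add_mem hb hc, by rw [pow_succ, pow_mul, hyc, hxb]; ring⟩

theorem minpoly_coeff_lt {abv : AbsoluteValue (Qpbar p) ℝ}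
    (habv : ∀ x : ℚ_[p], abv (algebraMap ℚ_[p] (Qpbar p) x) = ‖x‖) {a : Qpbar p} (ha : abv a < 1)
    (i : ℕ) (hi : i < (minpoly ℚ_[p] a).natDegree) : ‖(minpoly ℚ_[p] a).coeff i‖ < 1 := by
  have h := spectralNorm_unique_field_norm_ext (K := ℚ_[p]) (L := Qpbar p) habv a
  rw [h] at ha
  have h2 : spectralValueTerms (minpoly ℚ_[p] a) i ≤ spectralNorm ℚ_[p] (Qpbar p) a :=
    le_ciSup (spectralValueTerms_bddAbove (minpoly ℚ_[p] a)) i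
  rw [spectralValueTerms_of_lt_natDegree _ hi] at h2
  have h3 := h2.trans_lt ha
  by_contra hc
  push Not at hc
  have : (1:ℝ) ≤ ‖(minpoly ℚ_[p] a).coeff i‖ ^ (1 / ((minpoly ℚ_[p] a).natDegree - i : ℝ)) := by
    apply Real.one_le_rpow hc
    have : (i : ℝ) < (minpoly ℚ_[p] a).natDegree := by exact_mod_cast hi
    exact div_nonneg zero_le_one (by linarith)
  linarith

theorem Aur_nil {abv : AbsoluteValue (Qpbar p) ℝ}
    (habv : ∀ x : ℚ_[p], abv (algebraMap ℚ_[p] (Qpbar p) x) = ‖x‖) {d : ℕ} {a : Qpbar p}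
    (ha : a ∈ Aur p d) (h1 : abv a < 1) : ∃ n, ∃ b ∈ Aur p d, a ^ n = p * b := by
  set f := minpoly ℚ_[p] a with hf
  have hIntg : IsIntegral ℚ_[p] a := Algebra.IsIntegral.isIntegral a
  have hm : f.Monic := minpoly.monic hIntg
  have hc : ∀ i, ∃ s : ℤ_[p], i < f.natDegree → f.coeff i = p * s := by
    intro i
    by_cases hi : i < f.natDegree
    · have h := minpoly_coeff_lt habv h1 i hi
      obtain ⟨z, hz⟩ : ∃ z : ℤ_[p], (z : ℚ_[p]) = f.coeff i := ⟨⟨f.coeff i, h.le⟩, rfl⟩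
      obtain ⟨s, hs⟩ := (PadicInt.norm_lt_one_iff_dvd z).1 (by rw [PadicInt.norm_def, hz]; exact h)
      exact ⟨s, fun _ => by rw [← hz, hs]; simp⟩
    · exact ⟨0, fun h => absurd h hi⟩
  choose s hs using hc
  have h0 : aeval a f = 0 := minpoly.aeval _ _
  rw [aeval_eq_sum_range, Finset.sum_range_succ] at h0
  rw [hm.coeff_natDegree, one_smul] at h0
  refine ⟨f.natDegree, -∑ i ∈ Finset.range f.natDegree, algebraMap ℤ_[p] (Qpbar p) (s i) * a ^ i,
    neg_mem (sum_mem fun i _ => mul_mem (Subalgebra.algebraMap_mem _ _) (pow_mem ha _)), ?_⟩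
  have : ∑ i ∈ Finset.range f.natDegree, f.coeff i • a ^ i =
      p * ∑ i ∈ Finset.range f.natDegree, algebraMap ℤ_[p] (Qpbar p) (s i) * a ^ i := by
    rw [Finset.mul_sum]
    refine Finset.sum_congr rfl fun i hi => ?_
    rw [hs i (Finset.mem_range.1 hi), Algebra.smul_def, algMap_Zp]
    simp [mul_assoc]
  rw [this] at h0
  linear_combination h0

theorem Aur_div {abv : AbsoluteValue (Qpbar p) ℝ}
    (habv : ∀ x : ℚ_[p], abv (algebraMap ℚ_[p] (Qpbar p) x) = ‖x‖) {d : ℕ} (hd : 0 < d) {a : Qpbar p}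
    (ha : a ∈ Aur p d) (h1 : abv a < 1) : ∃ b ∈ Aur p d, a = p * b := by
  obtain ⟨n, b, hb, hab⟩ := Aur_nil habv ha h1
  obtain ⟨c, hc, hac⟩ := Aur_frob_iter ha n
  have h1 : 1 < p ^ d := Nat.one_lt_pow hd.ne' (Fact.out : p.Prime).one_lt
  have h2 : n ≤ (p ^ d) ^ n := (Nat.lt_pow_self h1).le
  obtain ⟨m, hm⟩ := Nat.exists_eq_add_of_le h2
  refine ⟨b * a ^ m - c, sub_mem (mul_mem hb (pow_mem ha m)) hc, ?_⟩
  rw [hm, pow_add, hab] at hac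
  linear_combination -hac

theorem Aur_le_one {abv : AbsoluteValue (Qpbar p) ℝ}
    (habv : ∀ x : ℚ_[p], abv (algebraMap ℚ_[p] (Qpbar p) x) = ‖x‖) {d : ℕ} (hd : 0 < d) {a : Qpbar p}
    (ha : a ∈ Aur p d) : abv a ≤ 1 := by
  induction ha using Algebra.adjoin_induction with
  | mem x hx => exact (abv_root hd hx).le
  | algebraMap r => rw [algMap_Zp, habv]; exact r.norm_le_one
  | add x y hx hy ihx ihy => exact (abv_nonarch habv _ _).trans (max_le ihx ihy)
  | mul x y hx hy ihx ihy => rw [map_mul]; exact mul_le_one₀ ihx (abv.nonneg _) ihy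

theorem p_inv_lt_one : (p : ℝ)⁻¹ < 1 :=
  inv_lt_one_of_one_lt₀ (by exact_mod_cast (Fact.out : p.Prime).one_lt)

theorem p_inv_pos : 0 < (p : ℝ)⁻¹ :=
  inv_pos.2 (by exact_mod_cast (Fact.out : p.Prime).pos)

theorem p_ne : (p : Qpbar p) ≠ 0 := by
  exact_mod_cast (Fact.out : p.Prime).ne_zero

theorem Aur_val {abv : AbsoluteValue (Qpbar p) ℝ}
    (habv : ∀ x : ℚ_[p], abv (algebraMap ℚ_[p] (Qpbar p) x) = ‖x‖) {d : ℕ} (hd : 0 < d) (k : ℕ) :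
    ∀ a ∈ Aur p d, ((p : ℝ)⁻¹) ^ k < abv a → ∃ j : ℕ, abv a = ((p : ℝ)⁻¹) ^ j := by
  induction k with
  | zero =>
    intro a ha h
    have := Aur_le_one habv hd ha
    simp at h; linarith
  | succ k ih =>
    intro a ha h
    rcases (Aur_le_one habv hd ha).lt_or_eq with h1 | h1
    · obtain ⟨b, hb, rfl⟩ := Aur_div habv hd ha h1
      rw [map_mul, abv_p habv, pow_succ'] at h
      obtain ⟨j, hj⟩ := ih b hb (lt_of_mul_lt_mul_left h p_inv_pos.le)
      exact ⟨j + 1, by rw [map_mul, abv_p habv, hj, pow_succ']⟩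
    · exact ⟨0, by simpa using h1⟩

theorem Aur_integral (a : Qpbar p) {d : ℕ} (hd : 0 < d) (ha : a ∈ Kur p d) :
    ∃ k : ℕ, p ^ k * a ∈ Aur p d := by
  have : (Kur p d).toSubalgebra = Algebra.adjoin ℚ_[p] {x : Qpbar p | x ^ (p ^ d - 1) = 1} := by
    exact IntermediateField.adjoin_toSubalgebra _
  have ha' : a ∈ Algebra.adjoin ℚ_[p] {x : Qpbar p | x ^ (p ^ d - 1) = 1} := this ▸ ha
  clear ha this
  induction ha' using Algebra.adjoin_induction with
  | mem x hx => exact ⟨0, by rw [pow_zero, one_mul]; exact Algebra.subset_adjoin hx⟩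
  | algebraMap r =>
    obtain ⟨k, hk⟩ := pow_unbounded_of_one_lt ‖r‖
      (show (1 : ℝ) < p by exact_mod_cast (Fact.out : p.Prime).one_lt)
    have hn : ‖(p : ℚ_[p]) ^ k * r‖ ≤ 1 := by
      rw [norm_mul, norm_pow, Padic.norm_p, inv_pow]
      exact inv_mul_le_one_of_le₀ hk.le (by positivity)
    obtain ⟨z, hz⟩ : ∃ z : ℤ_[p], (z : ℚ_[p]) = p ^ k * r := ⟨⟨_, hn⟩, rfl⟩
    refine ⟨k, ?_⟩
    have : (p ^ k * algebraMap ℚ_[p] (Qpbar p) r : Qpbar p) = algebraMap ℤ_[p] (Qpbar p) z := by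
      rw [algMap_Zp, hz]; simp
    rw [this]
    exact Subalgebra.algebraMap_mem _ _
  | add x y hx hy ihx ihy =>
    obtain ⟨k, hk⟩ := ihx
    obtain ⟨l, hl⟩ := ihy
    refine ⟨k + l, ?_⟩
    have : (p ^ (k + l) * (x + y) : Qpbar p) = p ^ l * (p ^ k * x) + p ^ k * (p ^ l * y) := by ring
    rw [this]
    exact add_mem (mul_mem (pow_mem (_root_.natCast_mem _ _) _) hk)
      (mul_mem (pow_mem (_root_.natCast_mem _ _) _) hl)
  | mul x y hx hy ihx ihy =>
    obtain ⟨k, hk⟩ := ihx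
    obtain ⟨l, hl⟩ := ihy
    refine ⟨k + l, ?_⟩
    have : (p ^ (k + l) * (x * y) : Qpbar p) = (p ^ k * x) * (p ^ l * y) := by ring
    rw [this]
    exact mul_mem hk hl

theorem Kur_val {abv : AbsoluteValue (Qpbar p) ℝ}
    (habv : ∀ x : ℚ_[p], abv (algebraMap ℚ_[p] (Qpbar p) x) = ‖x‖) {d : ℕ} (hd : 0 < d)
    {a : Qpbar p} (ha : a ∈ Kur p d) (h0 : a ≠ 0) : ∃ j : ℤ, abv a = (p : ℝ) ^ j := by
  obtain ⟨k, hk⟩ := Aur_integral a hd ha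
  have hpos : 0 < abv (p ^ k * a) := abv.pos (mul_ne_zero (pow_ne_zero _ p_ne) h0)
  obtain ⟨n, hn⟩ := exists_pow_lt_of_lt_one hpos (p_inv_lt_one (p := p))
  obtain ⟨j, hj⟩ := Aur_val habv hd n _ hk hn
  have hp0 : (p : ℝ) ≠ 0 := by exact_mod_cast (Fact.out : p.Prime).ne_zero
  rw [map_mul, map_pow, abv_p habv] at hj
  refine ⟨(k : ℤ) - j, ?_⟩
  rw [zpow_sub₀ hp0, zpow_natCast, zpow_natCast]
  rw [inv_pow, inv_pow, inv_mul_eq_iff_eq_mul₀ (pow_ne_zero _ hp0)] at hj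
  rw [hj, div_eq_mul_inv]

/-- Completeness of a finite extension. -/
theorem gen_complete {L : Type*} [NormedField L] [NormedAlgebra ℚ_[p] L]
    (K : IntermediateField ℚ_[p] L) [FiniteDimensional ℚ_[p] K] (s : ℕ → K) (C r : ℝ) (hr : r < 1)
    (h : ∀ n, ‖(s n : L) - s (n + 1)‖ ≤ C * r ^ n) :
    ∃ l : K, Tendsto (fun n => ‖(l : L) - s n‖) atTop (nhds 0) := by
  have hc : CompleteSpace K := FiniteDimensional.complete ℚ_[p] K
  have hcs : CauchySeq s := cauchySeq_of_le_geometric r C hr (fun n => by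
    rw [dist_eq_norm]; exact h n)
  obtain ⟨l, hl⟩ := cauchySeq_tendsto_of_complete hcs
  refine ⟨l, ?_⟩
  have := tendsto_iff_norm_sub_tendsto_zero.1 hl
  refine this.congr fun n => ?_
  rw [norm_sub_rev]; rfl

theorem abv_complete {abv : AbsoluteValue (Qpbar p) ℝ}
    (habv : ∀ x : ℚ_[p], abv (algebraMap ℚ_[p] (Qpbar p) x) = ‖x‖)
    (K : IntermediateField ℚ_[p] (Qpbar p)) [hf : FiniteDimensional ℚ_[p] K] (s : ℕ → K) (C r : ℝ)
    (hr : r < 1) (h : ∀ n, abv ((s n : Qpbar p) - s (n + 1)) ≤ C * r ^ n) :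
    ∃ l : K, Tendsto (fun n => abv ((l : Qpbar p) - s n)) atTop (nhds 0) := by
  let F : NormedField (Qpbar p) := abv.toNormedField
  let N : @NormedAlgebra ℚ_[p] (Qpbar p) _ F.toNormedCommRing.toSeminormedCommRing.toSeminormedRing :=
    { (inferInstance : Algebra ℚ_[p] (Qpbar p)) with
      norm_smul_le := fun r x => by
        rw [Algebra.smul_def]
        exact (abv.map_mul _ _).le.trans (by rw [habv]; rfl) }
  exact @gen_complete p _ (Qpbar p) F N K hf s C r hr h

theorem Kur_finite {d : ℕ} (hd : 0 < d) : FiniteDimensional ℚ_[p] (Kur p d) := by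
  have h1 : 1 < p ^ d := Nat.one_lt_pow hd.ne' (Fact.out : p.Prime).one_lt
  have hfin : {x : Qpbar p | x ^ (p ^ d - 1) = 1}.Finite := by
    refine Set.Finite.subset (Multiset.finite_toSet (nthRoots (p ^ d - 1) (1 : Qpbar p))) ?_
    intro x hx
    exact (mem_nthRoots (by omega)).2 hx
  have := hfin.to_subtype
  exact IntermediateField.finiteDimensional_adjoin fun x _ => Algebra.IsIntegral.isIntegral x

theorem abv_pow_sub_le {abv : AbsoluteValue (Qpbar p) ℝ}
    (habv : ∀ x : ℚ_[p], abv (algebraMap ℚ_[p] (Qpbar p) x) = ‖x‖) {x y : Qpbar p}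
    (hx : abv x ≤ 1) (hy : abv y ≤ 1) (i : ℕ) : abv (x ^ i - y ^ i) ≤ abv (x - y) := by
  induction i with
  | zero => simp
  | succ i ih =>
    have : x ^ (i + 1) - y ^ (i + 1) = x * (x ^ i - y ^ i) + (x - y) * y ^ i := by ring
    rw [this]
    refine (abv_nonarch habv _ _).trans (max_le ?_ ?_)
    · rw [map_mul]
      exact (mul_le_of_le_one_left (abv.nonneg _) hx).trans ih
    · rw [map_mul, map_pow]
      exact mul_le_of_le_one_right (abv.nonneg _) (pow_le_one₀ (abv.nonneg _) hy)

theorem abv_pow_p_sub_le {abv : AbsoluteValue (Qpbar p) ℝ}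
    (habv : ∀ x : ℚ_[p], abv (algebraMap ℚ_[p] (Qpbar p) x) = ‖x‖) {x y : Qpbar p}
    (hx : abv x ≤ 1) (hy : abv y ≤ 1) (hxy : abv (x - y) ≤ (p : ℝ)⁻¹) :
    abv (x ^ p - y ^ p) ≤ (p : ℝ)⁻¹ * abv (x - y) := by
  rw [← geom_sum₂_mul x y p, map_mul]
  refine mul_le_mul_of_nonneg_right ?_ (abv.nonneg _)
  have : ∑ i ∈ Finset.range p, x ^ i * y ^ (p - 1 - i) =
      ∑ i ∈ Finset.range p, (x ^ i - y ^ i) * y ^ (p - 1 - i) + p * y ^ (p - 1) := by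
    have h : (p * y ^ (p - 1) : Qpbar p) = ∑ i ∈ Finset.range p, y ^ i * y ^ (p - 1 - i) := by
      rw [Finset.sum_congr rfl (g := fun _ => y ^ (p - 1))]
      · simp
      · intro i hi
        rw [← pow_add]
        congr 1
        have := Finset.mem_range.1 hi
        omega
    rw [h, ← Finset.sum_add_distrib]
    exact Finset.sum_congr rfl fun i _ => by ring
  rw [this]
  refine (abv_nonarch habv _ _).trans (max_le ?_ ?_)
  · refine abv_sum_le habv _ _ _ p_inv_pos.le fun i _ => ?_
    rw [map_mul, map_pow]
    exact (mul_le_of_le_one_right (abv.nonneg _) (pow_le_one₀ (abv.nonneg _) hy)).trans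
      ((abv_pow_sub_le habv hx hy i).trans hxy)
  · rw [map_mul, map_pow, abv_p habv]
    exact mul_le_of_le_one_right p_inv_pos.le (pow_le_one₀ (abv.nonneg _) hy)

theorem hensel_AS {abv : AbsoluteValue (Qpbar p) ℝ}
    (habv : ∀ x : ℚ_[p], abv (algebraMap ℚ_[p] (Qpbar p) x) = ‖x‖) {d : ℕ} (hd : 0 < d)
    (c0 b : Kur p d) (hc0 : abv c0 ≤ 1) (h : abv ((c0 : Qpbar p) ^ p - c0 - b) ≤ (p : ℝ)⁻¹) :
    ∃ c : Kur p d, c ^ p - c = b := by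
  have := Kur_finite (p := p) hd
  have hp1 := p_inv_lt_one (p := p)
  have hp0 := p_inv_pos (p := p)
  have hb : abv b ≤ 1 := by
    have e : (b : Qpbar p) = (c0 ^ p - c0) - (c0 ^ p - c0 - b) := by ring
    rw [e]
    refine (abv_nonarch_sub habv _ _).trans (max_le ?_ (h.trans hp1.le))
    refine (abv_nonarch_sub habv _ _).trans (max_le ?_ hc0)
    rw [map_pow]; exact pow_le_one₀ (abv.nonneg _) hc0
  obtain ⟨s, hs0, hs⟩ : ∃ s : ℕ → Kur p d, s 0 = c0 ∧ ∀ n, s (n + 1) = s n ^ p - b :=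
    ⟨fun n => Nat.rec c0 (fun _ x => x ^ p - b) n, rfl, fun n => rfl⟩
  have hs' : ∀ n, ((s (n + 1) : Kur p d) : Qpbar p) = ((s n : Kur p d) : Qpbar p) ^ p - (b : Qpbar p) := fun n => by
    rw [hs]; push_cast; rfl
  have hs1 : ∀ n, abv (s n) ≤ 1 := by
    intro n
    induction n with
    | zero => rw [hs0]; exact hc0
    | succ n ih =>
      rw [hs']
      refine (abv_nonarch_sub habv _ _).trans (max_le ?_ hb)
      rw [map_pow]; exact pow_le_one₀ (abv.nonneg _) ih
  have hd1 : ∀ n, abv ((s (n + 1) : Qpbar p) - s n) ≤ (p : ℝ)⁻¹ ^ (n + 1) := by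
    intro n
    induction n with
    | zero =>
      rw [hs', zero_add, pow_one]
      have e : (s 0 : Qpbar p) ^ p - b - s 0 = (c0 : Qpbar p) ^ p - c0 - b := by
        rw [hs0]
        ring
      rw [e]; exact h
    | succ n ih =>
      have e : (s (n + 1 + 1) : Qpbar p) - s (n + 1) = (s (n + 1) : Qpbar p) ^ p - s n ^ p := by
        rw [hs' (n + 1), hs' n]; ring
      rw [e, pow_succ']
      have hle : (p : ℝ)⁻¹ ^ (n + 1) ≤ (p : ℝ)⁻¹ := by
        rw [pow_succ]
        exact mul_le_of_le_one_left hp0.le (pow_le_one₀ hp0.le hp1.le)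
      refine (abv_pow_p_sub_le habv (hs1 _) (hs1 _) (ih.trans hle)).trans ?_
      exact mul_le_mul_of_nonneg_left ih hp0.le
  obtain ⟨c, hc⟩ := abv_complete habv (Kur p d) s ((p : ℝ)⁻¹) ((p : ℝ)⁻¹) hp1 (fun n => by
    rw [abv.map_sub, ← pow_succ']; exact hd1 n)
  refine ⟨c, ?_⟩
  have hc1 : abv c ≤ 1 := by
    obtain ⟨n, hn⟩ := (hc.eventually_lt_const zero_lt_one).exists
    have e : (c : Qpbar p) = (c - s n) + s n := by ring
    rw [e]
    exact (abv_nonarch habv _ _).trans (max_le hn.le (hs1 n))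
  have hz : abv ((c : Qpbar p) ^ p - c - b) ≤ 0 := by
    refine ge_of_tendsto' (f := fun n => max (abv ((c : Qpbar p) - s n)) (abv ((c : Qpbar p) - s (n + 1))))
      (x := atTop) ?_ ?_
    · simpa using hc.max (hc.comp (tendsto_add_atTop_nat 1))
    · intro n
      have e : (c : Qpbar p) ^ p - c - b = ((c : Qpbar p) ^ p - s n ^ p) - (c - s (n + 1)) := by
        rw [hs' n]; ring
      rw [e]
      exact (abv_nonarch_sub habv _ _).trans (max_le_max (abv_pow_sub_le habv hc1 (hs1 n) p) le_rfl)
  have hz' : (c : Qpbar p) ^ p - c - b = 0 := abv.eq_zero.1 (le_antisymm hz (abv.nonneg _))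
  apply Subtype.ext
  push_cast
  linear_combination hz'

/-- `v_p(n!)` bound. -/
theorem abv_term_le {abv : AbsoluteValue (Qpbar p) ℝ}
    (habv : ∀ x : ℚ_[p], abv (algebraMap ℚ_[p] (Qpbar p) x) = ‖x‖) (hp : Odd p) {y : Qpbar p}
    (hy : abv y ≤ (p : ℝ)⁻¹) (n : ℕ) :
    ∃ m : ℕ, n ≤ 2 * m ∧ (2 ≤ n → 2 ≤ m) ∧ (1 ≤ n → 1 ≤ m) ∧
      abv (y ^ n / (Nat.factorial n : Qpbar p)) ≤ (p : ℝ)⁻¹ ^ m := by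
  have hp1 := p_inv_lt_one (p := p)
  have hp0 := p_inv_pos (p := p)
  rcases Nat.eq_zero_or_pos n with rfl | hn
  · exact ⟨0, by simp⟩
  have hp3 : 3 ≤ p := by
    have := (Fact.out : p.Prime).two_le
    obtain ⟨k, hk⟩ := hp
    omega
  have h1 := sub_one_mul_padicValNat_factorial_lt_of_ne_zero p hn.ne'
  set k := padicValNat p n.factorial with hk
  have h2 : 2 * k < n := lt_of_le_of_lt (Nat.mul_le_mul_right k (by omega)) h1
  refine ⟨n - k, by omega, by omega, by omega, ?_⟩
  have habs : abv (Nat.factorial n : Qpbar p) = (p : ℝ)⁻¹ ^ k := by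
    have := habv (n.factorial : ℚ_[p])
    rw [map_natCast] at this
    rw [this, Padic.norm_eq_zpow_neg_valuation (by exact_mod_cast n.factorial_ne_zero)]
    simp [hk]
  rw [map_div₀, map_pow, habs, div_le_iff₀ (by positivity), ← pow_add]
  have : n - k + k = n := by omega
  rw [this]
  exact pow_le_pow_left₀ (abv.nonneg _) hy n

theorem abv_term_le' {abv : AbsoluteValue (Qpbar p) ℝ}
    (habv : ∀ x : ℚ_[p], abv (algebraMap ℚ_[p] (Qpbar p) x) = ‖x‖) (hp : Odd p) {y : Qpbar p}
    (hy : abv y ≤ (p : ℝ)⁻¹) (n : ℕ) :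
    abv (y ^ n / (Nat.factorial n : Qpbar p)) ≤ Real.sqrt ((p : ℝ)⁻¹) ^ n := by
  have hp1 := p_inv_lt_one (p := p)
  have hp0 := p_inv_pos (p := p)
  obtain ⟨m, hm, -, -, h⟩ := abv_term_le habv hp hy n
  refine h.trans ?_
  nth_rw 1 [← Real.sq_sqrt hp0.le]
  rw [← pow_mul]
  exact pow_le_pow_of_le_one (Real.sqrt_nonneg _) (Real.sqrt_le_one.2 hp1.le) hm

theorem sqrt_lt_one : Real.sqrt ((p : ℝ)⁻¹) < 1 := by
  rw [Real.sqrt_lt' one_pos, one_pow]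
  exact p_inv_lt_one

theorem exp_exists {abv : AbsoluteValue (Qpbar p) ℝ}
    (habv : ∀ x : ℚ_[p], abv (algebraMap ℚ_[p] (Qpbar p) x) = ‖x‖) (hp : Odd p) {d : ℕ} (hd : 0 < d)
    (y : Kur p d) (hy : abv y ≤ (p : ℝ)⁻¹) : ∃ z : Kur p d, IsExpOf p abv y z := by
  have := Kur_finite (p := p) hd
  obtain ⟨l, hl⟩ := abv_complete habv (Kur p d)
    (fun N => ∑ n ∈ Finset.range N, y ^ n / (Nat.factorial n : Kur p d)) 1 (Real.sqrt ((p : ℝ)⁻¹))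
    sqrt_lt_one (fun n => by
      rw [Finset.sum_range_succ]
      push_cast
      rw [sub_add_cancel_left, abv.map_neg, one_mul]
      exact abv_term_le' habv hp hy n)
  refine ⟨l, ?_⟩
  unfold IsExpOf
  convert hl using 4
  push_cast
  rfl

theorem exp_unique {abv : AbsoluteValue (Qpbar p) ℝ} {y a b : Qpbar p}
    (ha : IsExpOf p abv y a) (hb : IsExpOf p abv y b) : a = b := by
  have h := ha.add hb
  have : abv (a - b) ≤ 0 + 0 := by
    refine ge_of_tendsto' h fun n => ?_
    have := abv.sub_le a (∑ k ∈ Finset.range n, y ^ k / (Nat.factorial k : Qpbar p)) b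
    rwa [abv.map_sub (∑ k ∈ Finset.range n, y ^ k / (Nat.factorial k : Qpbar p)) b] at this
  rw [add_zero] at this
  exact sub_eq_zero.1 (abv.eq_zero.1 (le_antisymm this (abv.nonneg _)))

theorem exp_zero' {abv : AbsoluteValue (Qpbar p) ℝ} : IsExpOf p abv 0 1 := by
  refine Tendsto.congr' ?_ tendsto_const_nhds
  filter_upwards [eventually_ge_atTop 1] with N hN
  obtain ⟨n, rfl⟩ := Nat.exists_eq_add_of_le' hN
  rw [Finset.sum_range_succ']
  simp

theorem add_pow_div_fact (a b : Qpbar p) (n : ℕ) :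
    (a + b) ^ n / (n.factorial : Qpbar p) = ∑ i ∈ Finset.range (n + 1),
      (a ^ i / (i.factorial : Qpbar p)) * (b ^ (n - i) / ((n - i).factorial : Qpbar p)) := by
  rw [add_pow, Finset.sum_div]
  refine Finset.sum_congr rfl fun i hi => ?_
  have hi' : i ≤ n := Nat.lt_succ_iff.1 (Finset.mem_range.1 hi)
  rw [Nat.cast_choose (Qpbar p) hi']
  have h1 : (n.factorial : Qpbar p) ≠ 0 := by exact_mod_cast n.factorial_ne_zero
  have h2 : (i.factorial : Qpbar p) ≠ 0 := by exact_mod_cast i.factorial_ne_zero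
  have h3 : ((n - i).factorial : Qpbar p) ≠ 0 := by exact_mod_cast (n - i).factorial_ne_zero
  field_simp

theorem exp_prod_bound {abv : AbsoluteValue (Qpbar p) ℝ}
    (habv : ∀ x : ℚ_[p], abv (algebraMap ℚ_[p] (Qpbar p) x) = ‖x‖) (hp : Odd p) {a b : Qpbar p}
    (ha : abv a ≤ (p : ℝ)⁻¹) (hb : abv b ≤ (p : ℝ)⁻¹) (N : ℕ) :
    abv ((∑ n ∈ Finset.range N, a ^ n / (Nat.factorial n : Qpbar p)) *
      (∑ n ∈ Finset.range N, b ^ n / (Nat.factorial n : Qpbar p)) -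
      ∑ n ∈ Finset.range N, (a + b) ^ n / (Nat.factorial n : Qpbar p)) ≤
      Real.sqrt ((p : ℝ)⁻¹) ^ N := by
  have e : (∑ n ∈ Finset.range N, (a + b) ^ n / (Nat.factorial n : Qpbar p)) =
      ∑ i ∈ Finset.range N, ∑ j ∈ Finset.range (N - i),
        (a ^ i / (i.factorial : Qpbar p)) * (b ^ j / (j.factorial : Qpbar p)) := by
    rw [← Finset.sum_range_diag_flip N
      (fun i j => (a ^ i / (i.factorial : Qpbar p)) * (b ^ j / (j.factorial : Qpbar p)))]
    exact Finset.sum_congr rfl fun n _ => add_pow_div_fact a b n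
  rw [e, Finset.sum_mul, ← Finset.sum_sub_distrib]
  refine abv_sum_le habv _ _ _ (by positivity) fun i hi => ?_
  rw [Finset.mul_sum, ← Finset.sum_Ico_eq_sub _ (Nat.sub_le N i)]
  refine abv_sum_le habv _ _ _ (by positivity) fun j hj => ?_
  rw [map_mul]
  refine (mul_le_mul (abv_term_le' habv hp ha i) (abv_term_le' habv hp hb j) (abv.nonneg _)
    (by positivity)).trans ?_
  rw [← pow_add]
  have := Finset.mem_Ico.1 hj
  exact pow_le_pow_of_le_one (Real.sqrt_nonneg _) sqrt_lt_one.le (by omega)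

theorem exp_add' {abv : AbsoluteValue (Qpbar p) ℝ}
    (habv : ∀ x : ℚ_[p], abv (algebraMap ℚ_[p] (Qpbar p) x) = ‖x‖) (hp : Odd p) {a b x y : Qpbar p}
    (ha : abv a ≤ (p : ℝ)⁻¹) (hb : abv b ≤ (p : ℝ)⁻¹) (hx : IsExpOf p abv a x)
    (hy : IsExpOf p abv b y) : IsExpOf p abv (a + b) (x * y) := by
  have hS : ∀ N, abv (∑ n ∈ Finset.range N, a ^ n / (Nat.factorial n : Qpbar p)) ≤ 1 := fun N =>
    abv_sum_le habv _ _ _ zero_le_one fun i _ => (abv_term_le' habv hp ha i).trans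
      (pow_le_one₀ (Real.sqrt_nonneg _) sqrt_lt_one.le)
  unfold IsExpOf at hx hy ⊢
  have h0 := (hx.mul_const (abv y)).add (hy.add
    (tendsto_pow_atTop_nhds_zero_of_lt_one (Real.sqrt_nonneg _) (sqrt_lt_one (p := p))))
  rw [zero_mul, add_zero, add_zero] at h0
  refine squeeze_zero (fun N => abv.nonneg _) (fun N => ?_) h0
  set A := ∑ n ∈ Finset.range N, a ^ n / (Nat.factorial n : Qpbar p) with hA
  set B := ∑ n ∈ Finset.range N, b ^ n / (Nat.factorial n : Qpbar p) with hB
  have e : x * y - ∑ n ∈ Finset.range N, (a + b) ^ n / (Nat.factorial n : Qpbar p) =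
    (x - A) * y + (A * (y - B) + (A * B -
      ∑ n ∈ Finset.range N, (a + b) ^ n / (Nat.factorial n : Qpbar p))) := by ring
  rw [e]
  refine (abv.add_le _ _).trans (add_le_add (map_mul _ _ _).le ((abv.add_le _ _).trans
    (add_le_add ?_ (exp_prod_bound habv hp ha hb N))))
  rw [map_mul]
  exact mul_le_of_le_one_left (abv.nonneg _) (hS N)

theorem exp_near {abv : AbsoluteValue (Qpbar p) ℝ}
    (habv : ∀ x : ℚ_[p], abv (algebraMap ℚ_[p] (Qpbar p) x) = ‖x‖) (hp : Odd p) {a x : Qpbar p}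
    (ha : abv a ≤ (p : ℝ)⁻¹) (hx : IsExpOf p abv a x) : abv (x - 1 - a) ≤ (p : ℝ)⁻¹ ^ 2 := by
  have hp1 := p_inv_lt_one (p := p)
  have hp0 := p_inv_pos (p := p)
  obtain ⟨N, hN⟩ := ((hx.comp (tendsto_add_atTop_nat 2)).eventually_lt_const
    (show (0 : ℝ) < (p : ℝ)⁻¹ ^ 2 by positivity)).exists
  simp only [Function.comp] at hN
  have e : x - 1 - a = (x - ∑ n ∈ Finset.range (N + 2), a ^ n / (Nat.factorial n : Qpbar p)) +
      ∑ n ∈ Finset.range N, a ^ (n + 2) / (Nat.factorial (n + 2) : Qpbar p) := by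
    rw [Finset.sum_range_succ', Finset.sum_range_succ']
    simp only [zero_add, pow_one, Nat.factorial_one, Nat.cast_one, div_one, pow_zero,
      Nat.factorial_zero]
    change _ = x - (∑ n ∈ Finset.range N, a ^ (n + 2) / (Nat.factorial (n + 2) : Qpbar p) + a + 1) + _
    ring
  rw [e]
  refine (abv_nonarch habv _ _).trans (max_le hN.le ?_)
  refine abv_sum_le habv _ _ _ (by positivity) fun i _ => ?_
  obtain ⟨m, -, hm, -, h⟩ := abv_term_le habv hp ha (i + 2)
  exact h.trans (pow_le_pow_of_le_one hp0.le hp1.le (hm (by omega)))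

theorem exp_near_one {abv : AbsoluteValue (Qpbar p) ℝ}
    (habv : ∀ x : ℚ_[p], abv (algebraMap ℚ_[p] (Qpbar p) x) = ‖x‖) (hp : Odd p) {a x : Qpbar p}
    (ha : abv a ≤ (p : ℝ)⁻¹) (hx : IsExpOf p abv a x) : abv (x - 1) ≤ (p : ℝ)⁻¹ := by
  have hp1 := p_inv_lt_one (p := p)
  have hp0 := p_inv_pos (p := p)
  have e : x - 1 = (x - 1 - a) + a := by ring
  rw [e]
  refine (abv_nonarch habv _ _).trans (max_le ((exp_near habv hp ha hx).trans ?_) ha)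
  rw [sq]; exact mul_le_of_le_one_left hp0.le hp1.le

theorem exp_ne_zero' {abv : AbsoluteValue (Qpbar p) ℝ}
    (habv : ∀ x : ℚ_[p], abv (algebraMap ℚ_[p] (Qpbar p) x) = ‖x‖) (hp : Odd p) {a x : Qpbar p}
    (ha : abv a ≤ (p : ℝ)⁻¹) (hx : IsExpOf p abv a x) : x ≠ 0 := by
  rintro rfl
  have := exp_near_one habv hp ha hx
  have hp1 := p_inv_lt_one (p := p)
  simp at this
  linarith

theorem exp_nsmul {abv : AbsoluteValue (Qpbar p) ℝ}
    (habv : ∀ x : ℚ_[p], abv (algebraMap ℚ_[p] (Qpbar p) x) = ‖x‖) (hp : Odd p) {a x : Qpbar p}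
    (ha : abv a ≤ (p : ℝ)⁻¹) (hx : IsExpOf p abv a x) (m : ℕ) :
    abv (m * a) ≤ (p : ℝ)⁻¹ ∧ IsExpOf p abv (m * a) (x ^ m) := by
  induction m with
  | zero => simpa using exp_zero'
  | succ m ih =>
    have e : ((m + 1 : ℕ) * a : Qpbar p) = m * a + a := by push_cast; ring
    rw [e, pow_succ]
    exact ⟨(abv_nonarch habv _ _).trans (max_le ih.1 ha), exp_add' habv hp ih.1 ha ih.2 hx⟩

theorem AS_root_abv {abv : AbsoluteValue (Qpbar p) ℝ}
    (habv : ∀ x : ℚ_[p], abv (algebraMap ℚ_[p] (Qpbar p) x) = ‖x‖) {t β : Qpbar p}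
    (hβ : abv β = p) (ht : t ^ p - t + β = 0) : abv t ^ p = p := by
  have hp1 : (1 : ℝ) < p := by exact_mod_cast (Fact.out : p.Prime).one_lt
  have e : β = t - t ^ p := by linear_combination ht
  have h1 : 1 < abv t := by
    by_contra hc
    push Not at hc
    have := abv_nonarch_sub habv t (t ^ p)
    rw [← e, hβ, map_pow] at this
    have h2 := max_le hc (pow_le_one₀ (n := p) (abv.nonneg t) hc)
    linarith
  have h2 : abv t < abv t ^ p := lt_self_pow₀ h1 (Fact.out : p.Prime).one_lt
  apply le_antisymm
  · have := abv_nonarch_sub habv t β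
    rw [e, sub_sub_cancel, ← e, map_pow] at this
    rcases le_max_iff.1 this with h | h
    · linarith
    · rwa [hβ] at h
  · have := abv_nonarch_sub habv t (t ^ p)
    rw [← e, hβ, map_pow, max_eq_right h2.le] at this
    exact this

theorem AS_minpoly {abv : AbsoluteValue (Qpbar p) ℝ}
    (habv : ∀ x : ℚ_[p], abv (algebraMap ℚ_[p] (Qpbar p) x) = ‖x‖) {d : ℕ} (hd : 0 < d)
    {t : Qpbar p} {β : Kur p d} (hβ : abv β = p) (ht : t ^ p - t + β = 0) :
    minpoly (Kur p d) t = X ^ p - X + C β ∧ (X ^ p - X + C β : (Kur p d)[X]).natDegree = p := by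
  have hpp := (Fact.out : p.Prime)
  have hp1 : (1 : ℝ) < p := by exact_mod_cast hpp.one_lt
  set f : (Kur p d)[X] := X ^ p - X + C β with hf
  have hlow : (-X + C β : (Kur p d)[X]).degree < p := by
    refine (degree_add_le _ _).trans_lt (max_lt ?_ ?_)
    · rw [degree_neg, degree_X]; exact_mod_cast hpp.one_lt
    · exact degree_C_le.trans_lt (by exact_mod_cast hpp.pos)
  have hf' : f = X ^ p + (-X + C β) := by rw [hf]; ring
  have hfm : f.Monic := by rw [hf']; exact monic_X_pow_add hlow
  have hfd : f.natDegree = p := by rw [hf']; exact natDegree_eq_of_degree_eq_some (by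
      rw [degree_add_eq_left_of_degree_lt (by rw [degree_X_pow]; exact hlow), degree_X_pow])
  have hev : ∀ s : Qpbar p, aeval s f = s ^ p - s + β := by
    intro s
    simp [hf]
  refine ⟨?_, hfd⟩
  set g := minpoly (Kur p d) t with hg
  have hIntg : IsIntegral (Kur p d) t := ⟨f, hfm, by rw [← aeval_def, hev, ht]⟩
  have hgm : g.Monic := minpoly.monic hIntg
  have hdvd : g ∣ f := minpoly.dvd _ _ (by rw [hev, ht])
  have hroot : ∀ s ∈ (g.map (algebraMap (Kur p d) (Qpbar p))).roots, abv s ^ p = p := by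
    intro s hs
    refine AS_root_abv habv hβ ?_
    rw [← hev]
    obtain ⟨h, hh⟩ := hdvd
    have : aeval s g = 0 := by
      have := (mem_roots'.1 hs).2
      rwa [IsRoot, eval_map_algebraMap] at this
    rw [hh, map_mul, this, zero_mul]
  have hsp : (g.map (algebraMap (Kur p d) (Qpbar p))).Splits := IsAlgClosed.splits _
  have hcard : (g.map (algebraMap (Kur p d) (Qpbar p))).roots.card = g.natDegree := by
    rw [← hsp.natDegree_eq_card_roots, hgm.natDegree_map]
  have hc0 := hsp.coeff_zero_eq_prod_roots_of_monic (hgm.map _)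
  rw [hgm.natDegree_map, coeff_map] at hc0
  have habs : abv (algebraMap (Kur p d) (Qpbar p) (g.coeff 0)) ^ p = (p : ℝ) ^ g.natDegree := by
    rw [hc0, map_mul, map_pow, abv.map_neg, map_one, one_pow, one_mul, map_multiset_prod,
      ← Multiset.prod_map_pow, ← hcard]
    rw [Multiset.map_congr rfl hroot, Multiset.map_const', Multiset.prod_replicate]
  have hne : (algebraMap (Kur p d) (Qpbar p) (g.coeff 0)) ≠ 0 := by
    intro h
    rw [h, map_zero, zero_pow hpp.ne_zero] at habs
    exact (pow_ne_zero _ (by linarith)) habs.symm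
  obtain ⟨j, hj⟩ := Kur_val habv hd (g.coeff 0).2 hne
  have hj' : abv (algebraMap (Kur p d) (Qpbar p) (g.coeff 0)) = (p : ℝ) ^ j := hj
  rw [hj', ← zpow_natCast, ← zpow_mul, ← zpow_natCast] at habs
  have hjj := zpow_right_injective₀ (by linarith) hp1.ne' habs
  have hpd : p ∣ g.natDegree := by
    have : (p : ℤ) ∣ g.natDegree := ⟨j, by linear_combination -hjj⟩
    exact_mod_cast this
  have hgp : p ≤ g.natDegree := Nat.le_of_dvd (minpoly.natDegree_pos hIntg) hpd
  exact (eq_of_monic_of_dvd_of_natDegree_le hgm hfm hdvd (by rw [hfd]; exact hgp)).symm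

theorem norm_of_minpoly {F M : Type*} [Field F] [Field M] [Algebra F M] [FiniteDimensional F M]
    (x : M) {n : ℕ} (hn : (minpoly F x).natDegree = n) (hodd : Odd n) :
    Algebra.norm F x = (-(minpoly F x).coeff 0) ^ (Module.finrank F M / n) := by
  have hIntg : IsIntegral F x := Algebra.IsIntegral.isIntegral x
  have h1 : Module.finrank F F⟮x⟯ = n := by rw [IntermediateField.adjoin.finrank hIntg, hn]
  have h2 := Module.finrank_mul_finrank F F⟮x⟯ M
  have hpos : 0 < n := hodd.pos
  rw [Algebra.norm_eq_norm_adjoin, ← h2, h1, Nat.mul_div_cancel_left _ hpos]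
  congr 1
  have h3 := Algebra.PowerBasis.norm_gen_eq_coeff_zero_minpoly (IntermediateField.adjoin.powerBasis hIntg)
  rw [IntermediateField.adjoin.powerBasis_gen, IntermediateField.adjoin.powerBasis_dim, hn,
    IntermediateField.minpoly_gen, hodd.neg_one_pow, neg_one_mul] at h3
  exact h3

theorem finrank_splitting_dvd {F L : Type*} [Field F] [CharZero F] [Field L] [IsAlgClosed L]
    [Algebra F L] (f : F[X]) (M : IntermediateField F L)
    (hM : M = IntermediateField.adjoin F (f.rootSet L)) :
    Module.finrank F M ∣ f.natDegree.factorial := by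
  have hs : (f.map (algebraMap F L)).Splits := IsAlgClosed.splits _
  have : IsSplittingField F M f := by
    subst hM; exact IntermediateField.adjoin_rootSet_isSplittingField hs
  have e := (IsSplittingField.algEquiv M f).toLinearEquiv.finrank_eq
  rw [e]
  have hg : IsGalois F f.SplittingField := ⟨⟩
  rw [← IsGalois.card_aut_eq_finrank F f.SplittingField]
  have : Fact ((f.map (algebraMap F L)).Splits) := ⟨hs⟩
  have h1 : Nat.card f.Gal ∣ Nat.card (Equiv.Perm (f.rootSet L)) :=
    Subgroup.card_dvd_of_injective _ (Gal.galActionHom_injective f L)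
  have h2 : Nat.card (Equiv.Perm (f.rootSet L)) ∣ f.natDegree.factorial := by
    rw [Nat.card_perm]
    exact Nat.factorial_dvd_factorial (ncard_rootSet_le f L)
  exact h1.trans h2

theorem Mfield_norm {abv : AbsoluteValue (Qpbar p) ℝ}
    (habv : ∀ x : ℚ_[p], abv (algebraMap ℚ_[p] (Qpbar p) x) = ‖x‖) (hp : Odd p) {d : ℕ} (hd : 0 < d)
    (v u β : Kur p d) (hv : abv v = 1) (hu : u * v ^ p = v) (hβ : β * p = v ^ p)
    [FiniteDimensional (Kur p d) (Mfield p d u)] :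
    ∃ m : ℕ, ¬ p ∣ m ∧ ∀ c y : Kur p d, y ≠ 0 → c ^ p - c = β * (y - 1) →
      ∃ z : Mfield p d u, z ≠ 0 ∧ Algebra.norm (Kur p d) z = y ^ m := by
  have hpp := (Fact.out : p.Prime)
  have hp0 : (p : ℝ) ≠ 0 := by exact_mod_cast hpp.ne_zero
  have hpK : (p : Kur p d) ≠ 0 := by exact_mod_cast hpp.ne_zero
  have hv0 : (v : Qpbar p) ≠ 0 := by
    intro h; rw [h, map_zero] at hv; exact zero_ne_one hv
  have hvK : v ≠ 0 := fun h => hv0 (by rw [h]; rfl)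
  have hbeta2 : (β : Qpbar p) * p = (v : Qpbar p) ^ p := by
    have := congrArg (fun x : Kur p d => (x : Qpbar p)) hβ
    simpa using this
  have hu' : (u : Qpbar p) * (v : Qpbar p) ^ p = v := by
    have := congrArg (fun x : Kur p d => (x : Qpbar p)) hu
    simpa using this
  have hβ0 : β ≠ 0 := by
    rintro rfl
    rw [zero_mul] at hβ
    exact pow_ne_zero _ hvK hβ.symm
  have hβa : abv β = p := by
    have := congrArg abv hbeta2
    rw [map_mul, map_pow, hv, one_pow, abv_p habv] at this
    field_simp at this
    exact this
  -- the polynomial over `K`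
  let ψ : (Kur p d)[X] := X * (X + C (u * p)) ^ (p - 1) + C (p : Kur p d)
  have hψmap : ψ.map (algebraMap (Kur p d) (Qpbar p)) = psiPoly p u := by
    simp [ψ, psiPoly]
  have hdeg1 : (X * (X + C (u * p)) ^ (p - 1) : (Kur p d)[X]).natDegree = p := by
    have hm : ((X + C (u * p)) ^ (p - 1) : (Kur p d)[X]).Monic := (monic_X_add_C _).pow _
    rw [natDegree_X_mul hm.ne_zero, (monic_X_add_C _).natDegree_pow, natDegree_X_add_C]
    have := hpp.pos
    omega
  have hψd : ψ.natDegree = p := by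
    simp only [ψ]
    rw [natDegree_add_C, hdeg1]
  have hψ0 : ψ ≠ 0 := by
    intro h; rw [h, natDegree_zero] at hψd; exact hpp.ne_zero hψd.symm
  have hset : {x : Qpbar p | (psiPoly p u).IsRoot x} = ψ.rootSet (Qpbar p) := by
    ext x
    rw [mem_rootSet, ← hψmap]
    change eval x _ = 0 ↔ _
    rw [eval_map_algebraMap]
    exact ⟨fun h => ⟨hψ0, h⟩, fun h => h.2⟩
  have hfr : Module.finrank (Kur p d) (Mfield p d u) ∣ p.factorial := by
    have := finrank_splitting_dvd ψ (Mfield p d u) (by rw [Mfield, hset])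
    rwa [hψd] at this
  -- a root
  obtain ⟨X0, hX0⟩ : ∃ x, (psiPoly p u).IsRoot x := by
    apply IsAlgClosed.exists_root
    rw [← hψmap, degree_map]
    intro h
    have := natDegree_eq_of_degree_eq_some h
    rw [hψd] at this
    exact hpp.ne_zero this
  have hXM : X0 ∈ Mfield p d u := IntermediateField.subset_adjoin _ _ hX0
  have hX : X0 * (X0 + u * p) ^ (p - 1) + p = 0 := by
    simpa [psiPoly] using hX0
  set Y := X0 + u * p with hY
  have hY0 : Y ≠ 0 := by
    intro h
    have : p - 1 ≠ 0 := by have := hpp.two_le; omega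
    rw [h, zero_pow this, mul_zero, zero_add] at hX
    exact p_ne hX
  have hYM : Y ∈ Mfield p d u := add_mem hXM (mul_mem (IntermediateField.algebraMap_mem _ u)
    (_root_.natCast_mem _ _))
  have hT : ((v : Qpbar p) / Y) ^ p - v / Y + β = 0 := by
    have hYp : Y ^ p = Y ^ (p - 1) * Y := by
      rw [← pow_succ]; congr 1; have := hpp.pos; omega
    have h1 : Y ^ p - u * p * Y ^ (p - 1) + p = 0 := by
      rw [hYp]; linear_combination hX - Y ^ (p - 1) * hY
    have h2 : (β : Qpbar p) = (v : Qpbar p) ^ p / p := by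
      rw [eq_div_iff p_ne, hbeta2]
    have h3 : (v : Qpbar p) / Y = u * v ^ p * Y ^ (p - 1) / Y ^ p := by
      rw [hu', hYp]
      have := pow_ne_zero (p - 1) hY0
      field_simp
    have h4 : Y ^ p ≠ 0 := pow_ne_zero _ hY0
    have h5 : (p : Qpbar p) ≠ 0 := p_ne
    rw [div_pow, h3, h2, div_sub_div_same, div_add_div _ _ h4 h5, div_eq_zero_iff]
    left
    linear_combination (v : Qpbar p) ^ p * h1
  set T : Qpbar p := (v : Qpbar p) / Y with hTdef
  have hTM : T ∈ Mfield p d u := div_mem (IntermediateField.algebraMap_mem _ v) hYM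
  obtain ⟨hmin, hdeg⟩ := AS_minpoly habv hd hβa hT
  let τ : Mfield p d u := ⟨T, hTM⟩
  have hminτ : minpoly (Kur p d) τ = X ^ p - X + C β := by
    rw [← hmin]
    exact (minpoly.algebraMap_eq (algebraMap (Mfield p d u) (Qpbar p)).injective τ).symm
  have hτ0 : τ ≠ 0 := by
    intro h
    have : T = 0 := congrArg Subtype.val h
    exact div_ne_zero hv0 hY0 this
  have hpdvd : p ∣ Module.finrank (Kur p d) (Mfield p d u) := by
    have h := minpoly.degree_dvd (K := Kur p d) (Algebra.IsIntegral.isIntegral τ)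
    rwa [hminτ, hdeg] at h
  refine ⟨Module.finrank (Kur p d) (Mfield p d u) / p, ?_, ?_⟩
  · intro h
    obtain ⟨k, hk⟩ := hpdvd
    rw [hk, Nat.mul_div_cancel_left _ hpp.pos] at h
    rw [hk, ← Nat.mul_factorial_pred hpp.ne_zero] at hfr
    have := (hpp.dvd_factorial).1 (h.trans (Nat.dvd_of_mul_dvd_mul_left hpp.pos hfr))
    have := hpp.pos
    omega
  · intro c y hy hc
    have hmc : minpoly (Kur p d) (τ - algebraMap (Kur p d) (Mfield p d u) c) =
        (X ^ p - X + C β : (Kur p d)[X]).comp (X + C c) := by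
      rw [minpoly.sub_algebraMap, hminτ]
    have hN1 := norm_of_minpoly (τ - algebraMap (Kur p d) (Mfield p d u) c) (n := p)
      (by rw [hmc, natDegree_comp, hdeg, natDegree_X_add_C, mul_one]) hp
    have hN2 := norm_of_minpoly τ (n := p) (by rw [hminτ, hdeg]) hp
    rw [hmc, coeff_zero_eq_eval_zero, eval_comp] at hN1
    rw [hminτ, coeff_zero_eq_eval_zero] at hN2
    simp only [eval_add, eval_sub, eval_pow, eval_X, eval_C, zero_add] at hN1
    simp only [eval_add, eval_sub, eval_pow, eval_X, eval_C, zero_add, zero_pow hpp.ne_zero,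
      sub_zero] at hN2
    have hN : Algebra.norm (Kur p d) ((τ - algebraMap (Kur p d) (Mfield p d u) c) / τ) =
        y ^ (Module.finrank (Kur p d) (Mfield p d u) / p) := by
      have hmul : Algebra.norm (Kur p d) ((τ - algebraMap (Kur p d) (Mfield p d u) c) / τ) *
          Algebra.norm (Kur p d) τ =
          Algebra.norm (Kur p d) (τ - algebraMap (Kur p d) (Mfield p d u) c) := by
        rw [← map_mul, div_mul_cancel₀ _ hτ0]
      have hne : Algebra.norm (Kur p d) τ ≠ 0 := by
        rw [hN2]; exact pow_ne_zero _ (neg_ne_zero.2 hβ0)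
      rw [eq_div_of_mul_eq hne hmul, hN1, hN2, ← div_pow, hc]
      congr 1
      field_simp
      ring
    refine ⟨_, ?_, hN⟩
    intro h
    rw [h] at hN
    rw [Algebra.norm_zero] at hN
    exact pow_ne_zero _ hy hN.symm

theorem unit_of_not_dvd {m : ℕ} (hm : ¬ p ∣ m) : ∃ r : ℤ_[p], (m : ℤ_[p]) * r = 1 := by
  have : IsUnit (m : ℤ_[p]) := by
    rw [PadicInt.isUnit_iff]
    by_contra h
    have h1 : ‖(m : ℤ_[p])‖ < 1 := lt_of_le_of_ne (PadicInt.norm_le_one _) h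
    have h2 := (PadicInt.norm_int_lt_one_iff_dvd (p := p) (m : ℤ)).1 (by exact_mod_cast h1)
    exact hm (by exact_mod_cast h2)
  obtain ⟨r, hr⟩ := this.exists_right_inv
  exact ⟨r, hr⟩

end helpers
/-- let `v ∈ μ_{q-1}`, `u = v^{1-p}` and `w ∈ μ_{q-1}`.  Then the set
`{exp(p v^{-p} (w - w^p) x) : x ∈ ℤ_p} ⊆ K` is a subgroup of `1 + P_K` (it contains `1`
and is closed under multiplication and inverses, and all its elements `y` satisfy
`|y - 1| ≤ p⁻¹`), and it is contained in the norm group `N(M_u/K)`. -/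
theorem statement12 (hp : Odd p) (d : ℕ) (hd : 0 < d)
    (abv : AbsoluteValue (Qpbar p) ℝ)
    (habv : ∀ x : ℚ_[p], abv (algebraMap ℚ_[p] (Qpbar p) x) = ‖x‖)
    (v : Qpbar p) (hv : v ^ (p ^ d - 1) = 1)
    (u : Qpbar p) (hu : u = v ^ ((1 : ℤ) - (p : ℤ)))
    (w : Qpbar p) (hw : w ^ (p ^ d - 1) = 1)
    [FiniteDimensional (Kur p d) (Mfield p d u)] :
    (∃ y : Kur p d, (∃ x : ℤ_[p], IsExpOf p abv
        ((p : Qpbar p) * (v ^ p)⁻¹ * (w - w ^ p) *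
          algebraMap ℚ_[p] (Qpbar p) (x : ℚ_[p])) ↑y) ∧ y = 1) ∧
    (∀ y₁ y₂ : Kur p d,
      (∃ x : ℤ_[p], IsExpOf p abv ((p : Qpbar p) * (v ^ p)⁻¹ * (w - w ^ p) *
        algebraMap ℚ_[p] (Qpbar p) (x : ℚ_[p])) ↑y₁) →
      (∃ x : ℤ_[p], IsExpOf p abv ((p : Qpbar p) * (v ^ p)⁻¹ * (w - w ^ p) *
        algebraMap ℚ_[p] (Qpbar p) (x : ℚ_[p])) ↑y₂) →
      (∃ x : ℤ_[p], IsExpOf p abv ((p : Qpbar p) * (v ^ p)⁻¹ * (w - w ^ p) *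
        algebraMap ℚ_[p] (Qpbar p) (x : ℚ_[p])) ↑(y₁ * y₂))) ∧
    (∀ y : Kur p d,
      (∃ x : ℤ_[p], IsExpOf p abv ((p : Qpbar p) * (v ^ p)⁻¹ * (w - w ^ p) *
        algebraMap ℚ_[p] (Qpbar p) (x : ℚ_[p])) ↑y) →
      (∃ x : ℤ_[p], IsExpOf p abv ((p : Qpbar p) * (v ^ p)⁻¹ * (w - w ^ p) *
        algebraMap ℚ_[p] (Qpbar p) (x : ℚ_[p])) ↑(y⁻¹))) ∧
    (∀ y : Kur p d,
      (∃ x : ℤ_[p], IsExpOf p abv ((p : Qpbar p) * (v ^ p)⁻¹ * (w - w ^ p) *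
        algebraMap ℚ_[p] (Qpbar p) (x : ℚ_[p])) ↑y) →
      abv (↑y - 1) ≤ (p : ℝ)⁻¹) ∧
    (∀ y : Kur p d,
      (∃ x : ℤ_[p], IsExpOf p abv ((p : Qpbar p) * (v ^ p)⁻¹ * (w - w ^ p) *
        algebraMap ℚ_[p] (Qpbar p) (x : ℚ_[p])) ↑y) →
      ∃ m : Mfield p d u, m ≠ 0 ∧ Algebra.norm (Kur p d) m = y) := by
  have hpp := (Fact.out : p.Prime)
  have hp1 := p_inv_lt_one (p := p)
  have hp0 := p_inv_pos (p := p)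
  have hva : abv v = 1 := abv_root hd hv
  have hwa : abv w = 1 := abv_root hd hw
  have hv0 : v ≠ 0 := by
    intro h; rw [h, map_zero] at hva; exact zero_ne_one hva
  have hvK : v ∈ Kur p d := IntermediateField.subset_adjoin _ _ hv
  have hwK : w ∈ Kur p d := IntermediateField.subset_adjoin _ _ hw
  have hE : ∀ x : ℤ_[p], abv ((p : Qpbar p) * (v ^ p)⁻¹ * (w - w ^ p) *
      algebraMap ℚ_[p] (Qpbar p) (x : ℚ_[p])) ≤ (p : ℝ)⁻¹ := by
    intro x
    have h1 : abv (w - w ^ p) ≤ 1 := by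
      refine (abv_nonarch_sub habv _ _).trans (max_le hwa.le ?_)
      rw [map_pow, hwa, one_pow]
    rw [map_mul, map_mul, map_mul, abv_p habv, map_inv₀, map_pow, hva, one_pow, inv_one, mul_one,
      habv, mul_assoc]
    exact mul_le_of_le_one_right hp0.le (mul_le_one₀ h1 (norm_nonneg _) x.norm_le_one)
  have hEK : ∀ x : ℤ_[p], ((p : Qpbar p) * (v ^ p)⁻¹ * (w - w ^ p) *
      algebraMap ℚ_[p] (Qpbar p) (x : ℚ_[p])) ∈ Kur p d := by
    intro x
    exact mul_mem (mul_mem (mul_mem (_root_.natCast_mem _ _) (inv_mem (pow_mem hvK _)))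
      (sub_mem hwK (pow_mem hwK _))) (IntermediateField.algebraMap_mem _ _)
  refine ⟨⟨1, ⟨0, ?_⟩, rfl⟩, ?_, ?_, ?_, ?_⟩
  · simpa using exp_zero' (p := p) (abv := abv)
  · rintro y₁ y₂ ⟨x₁, h₁⟩ ⟨x₂, h₂⟩
    refine ⟨x₁ + x₂, ?_⟩
    have := exp_add' habv hp (hE x₁) (hE x₂) h₁ h₂
    rw [← mul_add, ← map_add] at this
    simpa using this
  · rintro y ⟨x, hx⟩
    refine ⟨-x, ?_⟩
    obtain ⟨z, hz⟩ := exp_exists habv hp hd ⟨_, hEK (-x)⟩ (hE (-x))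
    have h := exp_add' habv hp (hE x) (hE (-x)) hx hz
    rw [← mul_add, ← map_add] at h
    have h1 : (y : Qpbar p) * z = 1 := exp_unique h (by simpa using exp_zero' (p := p) (abv := abv))
    have h2 : y⁻¹ = z := by
      apply inv_eq_of_mul_eq_one_right
      exact Subtype.ext h1
    rw [h2]
    exact hz
  · rintro y ⟨x, hx⟩
    exact exp_near_one habv hp (hE x) hx
  · rintro y ⟨x, hx⟩
    have huv : u * v ^ p = v := by
      rw [hu, ← zpow_natCast, ← zpow_add₀ hv0]
      simp
    have huK : u ∈ Kur p d := by
      rw [hu]; exact zpow_mem hvK _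
    let vK : Kur p d := ⟨v, hvK⟩
    let wK : Kur p d := ⟨w, hwK⟩
    let uK : Kur p d := ⟨u, huK⟩
    have hpK : (p : Kur p d) ≠ 0 := by exact_mod_cast hpp.ne_zero
    let β : Kur p d := vK ^ p / p
    have hβc : (β : Qpbar p) = v ^ p / p := by simp [β, vK]
    obtain ⟨m, hm, hmain⟩ := Mfield_norm habv hp hd vK uK β hva (Subtype.ext (by simpa using huv))
      (div_mul_cancel₀ _ hpK)
    obtain ⟨r, hr⟩ := unit_of_not_dvd hm
    obtain ⟨z, hz⟩ := exp_exists habv hp hd ⟨_, hEK (r * x)⟩ (hE (r * x))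
    have hzm := (exp_nsmul habv hp (hE (r * x)) hz m).2
    have hyz : y = z ^ m := by
      have hr' : (m : Qpbar p) * algebraMap ℚ_[p] (Qpbar p) (r : ℚ_[p]) = 1 := by
        have := congrArg (algebraMap ℤ_[p] (Qpbar p)) hr
        rw [map_mul, algMap_Zp r, map_natCast, map_one] at this
        exact this
      have e : (m : Qpbar p) * ((p : Qpbar p) * (v ^ p)⁻¹ * (w - w ^ p) *
          algebraMap ℚ_[p] (Qpbar p) ((r * x : ℤ_[p]) : ℚ_[p])) =
          (p : Qpbar p) * (v ^ p)⁻¹ * (w - w ^ p) * algebraMap ℚ_[p] (Qpbar p) (x : ℚ_[p]) := by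
        rw [PadicInt.coe_mul, map_mul]
        linear_combination ((p : Qpbar p) * (v ^ p)⁻¹ * (w - w ^ p) *
          algebraMap ℚ_[p] (Qpbar p) (x : ℚ_[p])) * hr'
      rw [e] at hzm
      exact Subtype.ext (by push_cast; exact exp_unique hx hzm)
    have hz0 : z ≠ 0 := fun h => exp_ne_zero' habv hp (hE (r * x)) hz (by rw [h]; rfl)
    have hnear := exp_near habv hp (hE (r * x)) hz
    obtain ⟨s, hs⟩ := Zp_pow_q 1 (r * x)
    set t : Qpbar p := algebraMap ℚ_[p] (Qpbar p) ((r * x : ℤ_[p]) : ℚ_[p]) with ht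
    have hta : abv t ≤ 1 := by rw [ht, habv]; exact (r * x).norm_le_one
    have htK : t ∈ Kur p d := IntermediateField.algebraMap_mem _ _
    have hts : t ^ p = t + p * algebraMap ℤ_[p] (Qpbar p) s := by
      have := congrArg (algebraMap ℤ_[p] (Qpbar p)) hs
      rw [pow_one, map_pow, map_add, algMap_Zp (r * x),
        map_mul (algebraMap ℤ_[p] (Qpbar p)) (p : ℤ_[p]) s, map_natCast] at this
      exact this
    have hsa : abv (algebraMap ℤ_[p] (Qpbar p) s) ≤ 1 := by
      rw [algMap_Zp, habv]; exact s.norm_le_one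
    obtain ⟨c, hc⟩ := hensel_AS habv hd (⟨-(t * w), neg_mem (mul_mem htK hwK)⟩) (β * (z - 1))
      (by
        change abv (-(t * w)) ≤ 1
        rw [abv.map_neg, map_mul, hwa, mul_one]; exact hta)
      (by
        change abv ((-(t * w)) ^ p - -(t * w) - ((β * (z - 1) : Kur p d) : Qpbar p)) ≤ _
        have e : (-(t * w)) ^ p - -(t * w) - ((β * (z - 1) : Kur p d) : Qpbar p) =
            -(p * (algebraMap ℤ_[p] (Qpbar p) s * w ^ p) +
              β * ((z : Qpbar p) - 1 - (p : Qpbar p) * (v ^ p)⁻¹ * (w - w ^ p) * t)) := by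
          push_cast
          rw [hβc, hp.neg_pow, mul_pow, hts]
          have h5 : (p : Qpbar p) ≠ 0 := p_ne
          have h6 : v ^ p ≠ 0 := pow_ne_zero _ hv0
          field_simp
          ring
        rw [e, abv.map_neg]
        refine (abv_nonarch habv _ _).trans (max_le ?_ ?_)
        · rw [map_mul, map_mul, map_pow, hwa, one_pow, mul_one, abv_p habv]
          exact mul_le_of_le_one_right hp0.le hsa
        · rw [map_mul, hβc, map_div₀, map_pow, hva, one_pow, abv_p habv, one_div]
          refine (mul_le_mul_of_nonneg_left hnear (by positivity)).trans (le_of_eq ?_)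
          have : (p : ℝ) ≠ 0 := by exact_mod_cast hpp.ne_zero
          field_simp)
    obtain ⟨n, hn0, hn⟩ := hmain c z hz0 hc
    exact ⟨n, hn0, hn.trans hyz.symm⟩
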